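/- arXiv:1711.04882 — 4 statements merged into one kernel-verified Lean document; each statement's English description precedes it below -/
import Mathlib

section
/- Let (X', S', k') be a partial set cover instance: X' a finite set, S' = {S_1, ..., S_m} a finite list of subsets of X' sorted so that their nonnegative weights satisfy w_1 ≤ w_2 ≤ ... ≤ w_m, and k' an integer. Suppose Σ* ⊆ S' is a minimum-weight collection covering at least k' elements of X', and let p be the largest index of a set in Σ*. Then OPT(X', S', k') = OPT(X' \ S_p, {S_1, ..., S_{p-1}}, k' − |S_p|) + w_p, where for an instance (X, S, k), OPT(X, S, k) denotes the minimum total weight of a subcollection of S whose union contains at least k elements of X (restricting each set of S to X), and a coverage requirement k ≤ 0 is satisfied by the empty collection. -/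
open Finset

/-- `OPT Sset w coll X k` is the minimum total weight of a subcollection `T` of the sets
indexed by `coll` whose union contains at least `k` elements of `X` (each set restricted
to `X`); a requirement `k ≤ 0` is satisfied by the empty collection since cardinalities
are nonnegative. -/
noncomputable def OPT {V ι : Type*} [DecidableEq V] [DecidableEq ι]
    (Sset : ι → Finset V) (w : ι → ℝ) (coll : Finset ι) (X : Finset V) (k : ℤ) : ℝ :=
  sInf {c : ℝ | ∃ T ⊆ coll, k ≤ ((X ∩ T.biUnion Sset).card : ℤ) ∧ T.sum w = c}

/-- if `Σ*` is a minimum-weight collection covering at least `k'` elements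
of `X'`, the sets are sorted by nondecreasing nonnegative weights, and `p` is the largest
index of a set in `Σ*`, then
`OPT(X', S', k') = OPT(X' \ S_p, {S_1, …, S_{p-1}}, k' - |S_p|) + w_p`. -/
theorem stmt0 {V : Type*} [DecidableEq V] {m : ℕ}
    (X' : Finset V) (Sset : Fin m → Finset V) (w : Fin m → ℝ) (k' : ℤ)
    (hsub : ∀ i, Sset i ⊆ X')
    (hw0 : ∀ i, 0 ≤ w i) (hmono : Monotone w)
    (Sopt : Finset (Fin m)) (p : Fin m)
    (hfeas : k' ≤ ((X' ∩ Sopt.biUnion Sset).card : ℤ))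
    (hopt : ∀ T : Finset (Fin m),
      k' ≤ ((X' ∩ T.biUnion Sset).card : ℤ) → Sopt.sum w ≤ T.sum w)
    (hp : p ∈ Sopt) (hpmax : ∀ i ∈ Sopt, i ≤ p) :
    OPT Sset w Finset.univ X' k' =
      OPT Sset w (Finset.Iio p) (X' \ Sset p) (k' - (Sset p).card) + w p := by
  have key : ∀ T : Finset (Fin m), (X' ∩ (insert p T).biUnion Sset).card =
      (Sset p).card + ((X' \ Sset p) ∩ T.biUnion Sset).card := by
    intro T
    rw [← Finset.card_union_of_disjoint]
    · congr 1
      ext x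
      have := @hsub p x
      simp only [Finset.biUnion_insert, Finset.mem_inter, Finset.mem_union, Finset.mem_sdiff]
      tauto
    · rw [Finset.disjoint_left]
      intro x hx hx2
      simp only [Finset.mem_inter, Finset.mem_sdiff] at hx2
      exact hx2.1.2 hx
  have h1 : IsLeast {c : ℝ | ∃ T ⊆ (Finset.univ : Finset (Fin m)),
      k' ≤ ((X' ∩ T.biUnion Sset).card : ℤ) ∧ T.sum w = c} (Sopt.sum w) := by
    refine ⟨⟨Sopt, Finset.subset_univ _, hfeas, rfl⟩, ?_⟩
    rintro c ⟨T, -, hT, rfl⟩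
    exact hopt T hT
  have hsum := Finset.sum_erase_add Sopt w hp
  have h2 : IsLeast {c : ℝ | ∃ T ⊆ Finset.Iio p,
      k' - (Sset p).card ≤ (((X' \ Sset p) ∩ T.biUnion Sset).card : ℤ) ∧ T.sum w = c}
      ((Sopt.erase p).sum w) := by
    refine ⟨⟨Sopt.erase p, ?_, ?_, rfl⟩, ?_⟩
    · intro i hi
      rw [Finset.mem_erase] at hi
      exact Finset.mem_Iio.2 (lt_of_le_of_ne (hpmax i hi.2) hi.1)
    · have := key (Sopt.erase p)
      rw [Finset.insert_erase hp] at this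
      omega
    · rintro c ⟨T, hTp, hT, rfl⟩
      have hk := key T
      have hpT : p ∉ T := fun h => lt_irrefl p (Finset.mem_Iio.1 (hTp h))
      have := hopt (insert p T) (by omega)
      rw [Finset.sum_insert hpT] at this
      linarith
  unfold OPT
  rw [h1.csInf_eq, h2.csInf_eq, hsum]
end

section
/- Let (X', S', k') be a partial set cover instance with nonnegative set weights, let Σ* be an optimal solution, and let S_p ∈ Σ* be a maximum-weight set in Σ*, with weight w_p. Consider the residual instance (X_p, S_p-coll, k_p) with X_p = X' \ S_p, S_p-coll ⊇ Σ* \ {S_p}, and k_p = k' − |S_p|. Suppose Σ_p ⊆ S_p-coll covers at least k_p elements of X_p and satisfies w(Σ_p) ≤ c · OPT(X_p, S_p-coll, k_p) + w_p for some constant c ≥ 2. Then Σ_p ∪ {S_p} covers at least k' elements of X' and w(Σ_p ∪ {S_p}) ≤ c · OPT(X', S', k'). -/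
open Finset

/-- if `Σ*` is an optimal solution for `(X', S', k')`, `S_p ∈ Σ*` has maximum
weight in `Σ*`, and `Σ_p ⊆ S_p-coll` (where `S_p-coll ⊇ Σ* \ {S_p}`) covers at least
`k' - |S_p|` elements of `X' \ S_p` with
`w(Σ_p) ≤ c ⬝ OPT(X' \ S_p, S_p-coll, k' - |S_p|) + w_p` for some `c ≥ 2`, then
`Σ_p ∪ {S_p}` covers at least `k'` elements of `X'` and has weight at most
`c ⬝ OPT(X', S', k')`. -/
theorem stmt1 {V ι : Type*} [DecidableEq V] [DecidableEq ι]
    (X' : Finset V) (Sset : ι → Finset V) (w : ι → ℝ) (k' : ℤ) (c : ℝ)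
    (coll : Finset ι)
    (hsub : ∀ i ∈ coll, Sset i ⊆ X')
    (hw0 : ∀ i, 0 ≤ w i) (hc : 2 ≤ c)
    (Sopt : Finset ι) (p : ι)
    (hSoptsub : Sopt ⊆ coll)
    (hfeas : k' ≤ ((X' ∩ Sopt.biUnion Sset).card : ℤ))
    (hopt : ∀ T ⊆ coll, k' ≤ ((X' ∩ T.biUnion Sset).card : ℤ) → Sopt.sum w ≤ T.sum w)
    (hp : p ∈ Sopt) (hpmax : ∀ i ∈ Sopt, w i ≤ w p)
    (Spcoll : Finset ι) (hSpcoll : Sopt.erase p ⊆ Spcoll)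
    (Sigp : Finset ι) (hSigp : Sigp ⊆ Spcoll)
    (hcov : (k' - (Sset p).card : ℤ) ≤ (((X' \ Sset p) ∩ Sigp.biUnion Sset).card : ℤ))
    (hwbound : Sigp.sum w ≤
      c * OPT Sset w Spcoll (X' \ Sset p) (k' - (Sset p).card) + w p) :
    k' ≤ ((X' ∩ (insert p Sigp).biUnion Sset).card : ℤ) ∧
      (insert p Sigp).sum w ≤ c * OPT Sset w coll X' k' := by
  have hpX : Sset p ⊆ X' := hsub p (hSoptsub hp)
  have key : ∀ T : Finset ι, ((X' ∩ (insert p T).biUnion Sset).card : ℤ) =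
      (Sset p).card + (((X' \ Sset p) ∩ T.biUnion Sset).card : ℤ) := by
    intro T
    have h1 : X' ∩ (insert p T).biUnion Sset =
        Sset p ∪ ((X' \ Sset p) ∩ T.biUnion Sset) := by
      rw [Finset.biUnion_insert]
      ext x
      have := @hpX x
      simp only [Finset.mem_inter, Finset.mem_union, Finset.mem_sdiff]
      tauto
    have h2 : Disjoint (Sset p) ((X' \ Sset p) ∩ T.biUnion Sset) := by
      rw [Finset.disjoint_left]
      intro x hx hx2
      simp only [Finset.mem_inter, Finset.mem_sdiff] at hx2
      exact hx2.1.2 hx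
    rw [h1, Finset.card_union_of_disjoint h2]
    push_cast
    rfl
  refine ⟨by rw [key]; linarith, ?_⟩
  have hO : Sopt.sum w ≤ OPT Sset w coll X' k' := by
    unfold OPT
    apply le_csInf
    · exact ⟨_, Sopt, hSoptsub, hfeas, rfl⟩
    · rintro b ⟨T, hT, hk, rfl⟩
      exact hopt T hT hk
  have hR : OPT Sset w Spcoll (X' \ Sset p) (k' - (Sset p).card) ≤ (Sopt.erase p).sum w := by
    unfold OPT
    apply csInf_le
    · refine ⟨0, ?_⟩
      rintro b ⟨T, hT, hk, rfl⟩
      exact Finset.sum_nonneg fun i _ => hw0 i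
    · refine ⟨Sopt.erase p, hSpcoll, ?_, rfl⟩
      have := key (Sopt.erase p)
      rw [Finset.insert_erase hp] at this
      linarith
  have hE : (Sopt.erase p).sum w + w p = Sopt.sum w := Finset.sum_erase_add _ _ hp
  have hI : (insert p Sigp).sum w ≤ w p + Sigp.sum w := by
    by_cases h : p ∈ Sigp
    · rw [Finset.insert_eq_of_mem h]
      linarith [hw0 p]
    · rw [Finset.sum_insert h]
  have hp0 := hw0 p
  have h1 := mul_le_mul_of_nonneg_left hO (by linarith : 0 ≤ c)
  have h2 := mul_le_mul_of_nonneg_left hR (by linarith : 0 ≤ c)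
  have h3 := mul_le_mul_of_nonneg_right hc hp0
  rw [← hE, mul_add] at h1
  linarith
end

section
/- Let (X_p, S_p, k_p) be a partial set cover instance with nonnegative set weights, and let σ* = (x, z) be a feasible solution of its LP relaxation: x_i ∈ [0,1] for each set S_i ∈ S_p, z_j ∈ [0,1] for each element e_j ∈ X_p, Σ_{i : e_j ∈ S_i} x_i ≥ z_j for every e_j ∈ X_p, and Σ_{e_j ∈ X_p} z_j ≥ k_p. Fix α with 0 < α ≤ 1/2, let X_1 = { e_j ∈ X_p : Σ_{i : e_j ∈ S_i} x_i ≥ α }, let S_1 = { S_i ∈ S_p : x_i ≥ α }, and assume ⋃_{S ∈ S_1} S ∩ X_p ⊆ X_1. Then the restriction of (x, z) to X = X_p \ X_1 and S = S_p \ S_1 is feasible for the partial set cover LP on the instance (X, S, k) with k = k_p − |X_1|: namely Σ_{i : e_j ∈ S_i, S_i ∈ S} x_i ≥ z_j for every e_j ∈ X, Σ_{e_j ∈ X} z_j ≥ k_p − |X_1|, and the restricted cost Σ_{S_i ∈ S} w_i x_i is at most Σ_{S_i ∈ S_p} w_i x_i. -/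
open Finset

/-- given a feasible solution `(x, z)` of the partial set cover LP for
`(X_p, S_p, k_p)` and `0 < a ≤ 1/2`, with `X₁` the elements covered to extent at least
`a` and `S₁` the sets with `x_i ≥ a`, assuming `⋃ S₁ ∩ X_p ⊆ X₁`, the restriction of
`(x, z)` to `X = X_p \ X₁` and `S = S_p \ S₁` is feasible for the partial set cover LP
on `(X, S, k_p - |X₁|)`, and the restricted cost is at most the original cost. -/
theorem stmt3 {V ι : Type*} [DecidableEq V] [Fintype ι]
    (Xp : Finset V) (Sset : ι → Finset V) (w : ι → ℝ) (kp : ℤ)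
    (x : ι → ℝ) (z : V → ℝ) (a : ℝ)
    (hw : ∀ i, 0 ≤ w i)
    (hx : ∀ i, x i ∈ Set.Icc (0:ℝ) 1) (hz : ∀ e ∈ Xp, z e ∈ Set.Icc (0:ℝ) 1)
    (hconstr : ∀ e ∈ Xp, z e ≤ ∑ i ∈ Finset.univ.filter (fun i => e ∈ Sset i), x i)
    (hk : (kp : ℝ) ≤ ∑ e ∈ Xp, z e)
    (ha : 0 < a) (ha2 : a ≤ 1/2)
    (hunion : ((Finset.univ.filter (fun i => a ≤ x i)).biUnion Sset) ∩ Xp ⊆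
      Xp.filter (fun e => a ≤ ∑ i ∈ Finset.univ.filter (fun i => e ∈ Sset i), x i)) :
    (∀ e ∈ Xp \ Xp.filter
        (fun e => a ≤ ∑ i ∈ Finset.univ.filter (fun i => e ∈ Sset i), x i),
      z e ≤ ∑ i ∈ Finset.univ.filter (fun i => e ∈ Sset i ∧ ¬ a ≤ x i), x i) ∧
    ((kp : ℝ) - (Xp.filter
        (fun e => a ≤ ∑ i ∈ Finset.univ.filter (fun i => e ∈ Sset i), x i)).card ≤
      ∑ e ∈ Xp \ Xp.filter
        (fun e => a ≤ ∑ i ∈ Finset.univ.filter (fun i => e ∈ Sset i), x i), z e) ∧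
    ∑ i ∈ Finset.univ.filter (fun i => ¬ a ≤ x i), w i * x i ≤ ∑ i, w i * x i := by
  refine ⟨?_, ?_, ?_⟩
  · intro e he
    obtain ⟨heX, he1⟩ := Finset.mem_sdiff.mp he
    refine (hconstr e heX).trans (le_of_eq ?_)
    refine Finset.sum_congr ?_ (fun _ _ => rfl)
    ext i
    simp only [Finset.mem_filter, Finset.mem_univ, true_and]
    refine ⟨fun hi => ⟨hi, fun hai => he1 (hunion ?_)⟩, fun h => h.1⟩
    refine Finset.mem_inter.mpr ⟨Finset.mem_biUnion.mpr ⟨i, ?_, hi⟩, heX⟩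
    exact Finset.mem_filter.mpr ⟨Finset.mem_univ i, hai⟩
  · set X1 := Xp.filter
      (fun e => a ≤ ∑ i ∈ Finset.univ.filter (fun i => e ∈ Sset i), x i) with hX1
    have hsub : X1 ⊆ Xp := Finset.filter_subset _ _
    have h1 := Finset.sum_sdiff (f := z) hsub
    have h2 : ∑ e ∈ X1, z e ≤ (X1.card : ℝ) := by
      have := Finset.sum_le_card_nsmul X1 z 1 (fun e he => (hz e (hsub he)).2)
      simpa using this
    linarith
  · exact Finset.sum_le_sum_of_subset_of_nonneg (Finset.filter_subset _ _)
      (fun i _ _ => mul_nonneg (hw i) (hx i).1)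
end

section
/- Let X be a finite set, S a finite collection of subsets of X with nonnegative weights, k an integer, and α ∈ (0, 1/2]. Suppose (x, z) is a feasible partial set cover LP solution for (X, S, k) in which every set is shallow-valued and every element is shallow: x_i < α for all S_i ∈ S, and Σ_{i : e_j ∈ S_i} x_i ≤ α for all e_j ∈ X (hence z_j ≤ α for all j). Then there exists a collection Σ' ⊆ S that covers at least k elements of X and satisfies w(Σ') ≤ (1/α) · Σ_{S_i ∈ S} w_i x_i + B, where B is the maximum weight of a set in S. -/
open Finset

/-- Multilinear extension of coverage. -/
noncomputable def covG {V ι : Type*} [Fintype ι] (X : Finset V) (u : V → ι → ℝ) (y : ι → ℝ) : ℝ :=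
  ∑ e ∈ X, (1 - ∏ k, (1 - u e k * y k))

/-- shifting mass between two coordinates -/
noncomputable def shiftY {ι : Type*} [DecidableEq ι] (w y : ι → ℝ) (i j : ι) (t : ℝ) : ι → ℝ :=
  fun k => if k = i then y i + t * w j else if k = j then y j - t * w i else y k

lemma shiftY_swap {ι : Type*} [DecidableEq ι] (w y : ι → ℝ) {i j : ι} (hij : i ≠ j) (t : ℝ) :
    shiftY w y j i t = shiftY w y i j (-t) := by
  funext k
  unfold shiftY
  by_cases h1 : k = i
  · subst h1; simp [hij]; ring
  · by_cases h2 : k = j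
    · subst h2; simp [h1]
    · simp [h1, h2]

lemma prod_pair_split {ι : Type*} [Fintype ι] [DecidableEq ι] (f : ι → ℝ) {i j : ι} (hij : i ≠ j) :
    ∏ k, f k = f i * (f j * ∏ k ∈ (univ.erase i).erase j, f k) := by
  rw [Finset.mul_prod_erase _ f (by simp [hij.symm]), Finset.mul_prod_erase _ f (by simp)]

lemma sum_pair_split {ι : Type*} [Fintype ι] [DecidableEq ι] (f : ι → ℝ) {i j : ι} (hij : i ≠ j) :
    ∑ k, f k = f i + (f j + ∑ k ∈ (univ.erase i).erase j, f k) := by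
  rw [Finset.add_sum_erase _ f (by simp [hij.symm]), Finset.add_sum_erase _ f (by simp)]

lemma shift_weight {ι : Type*} [Fintype ι] [DecidableEq ι] (w y : ι → ℝ) {i j : ι} (hij : i ≠ j)
    (t : ℝ) : ∑ k, w k * shiftY w y i j t k = ∑ k, w k * y k := by
  rw [sum_pair_split _ hij, sum_pair_split (fun k => w k * y k) hij]
  have : ∑ k ∈ (univ.erase i).erase j, w k * shiftY w y i j t k
      = ∑ k ∈ (univ.erase i).erase j, w k * y k := by
    apply Finset.sum_congr rfl
    intro k hk
    simp only [Finset.mem_erase] at hk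
    simp [shiftY, hk.1, hk.2.1]
  rw [this]
  simp only [shiftY, if_true, hij.symm, if_false]
  ring

lemma covG_shift {V ι : Type*} [Fintype ι] [DecidableEq ι] (X : Finset V) (u : V → ι → ℝ)
    (hu0 : ∀ e k, 0 ≤ u e k) (hu1 : ∀ e k, u e k ≤ 1) (w y : ι → ℝ) (hw : ∀ k, 0 ≤ w k)
    (hy : ∀ k, y k ∈ Set.Icc (0:ℝ) 1) {i j : ι} (hij : i ≠ j) :
    ∃ c : ℝ, ∀ t, covG X u y + c * t ≤ covG X u (shiftY w y i j t) := by
  have key : ∀ e, ∃ c : ℝ, ∀ t, (1 - ∏ k, (1 - u e k * y k)) + c * t ≤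
      1 - ∏ k, (1 - u e k * shiftY w y i j t k) := by
    intro e
    set R := ∏ k ∈ (univ.erase i).erase j, (1 - u e k * y k) with hR
    have hR0 : 0 ≤ R := by
      apply Finset.prod_nonneg
      intro k _
      nlinarith [hu0 e k, hu1 e k, (hy k).1, (hy k).2]
    refine ⟨-(R * ((1 - u e i * y i) * (u e j * w i) - (1 - u e j * y j) * (u e i * w j))), ?_⟩
    intro t
    rw [prod_pair_split _ hij, prod_pair_split (fun k => 1 - u e k * shiftY w y i j t k) hij]
    have : ∏ k ∈ (univ.erase i).erase j, (1 - u e k * shiftY w y i j t k) = R := by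
      apply Finset.prod_congr rfl
      intro k hk
      simp only [Finset.mem_erase] at hk
      simp [shiftY, hk.1, hk.2.1]
    rw [this, ← hR]
    simp only [shiftY, if_true, hij.symm, if_false]
    have h2 : 0 ≤ R * (u e i * w j) * (u e j * w i) * (t * t) := by
      have := hu0 e i
      have := hu0 e j
      have := hw i
      have := hw j
      have := mul_self_nonneg t
      positivity
    nlinarith [h2]
  choose c hc using key
  refine ⟨∑ e ∈ X, c e, fun t => ?_⟩
  unfold covG
  rw [Finset.sum_mul, ← Finset.sum_add_distrib]
  exact Finset.sum_le_sum fun e _ => hc e t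

lemma covG_mono {V ι : Type*} [Fintype ι] (X : Finset V) (u : V → ι → ℝ)
    (hu0 : ∀ e k, 0 ≤ u e k) (hu1 : ∀ e k, u e k ≤ 1) (y y' : ι → ℝ)
    (h1 : ∀ k, y' k ≤ 1) (h0 : ∀ k, 0 ≤ y' k) (h : ∀ k, y k ≤ y' k) :
    covG X u y ≤ covG X u y' := by
  unfold covG
  apply Finset.sum_le_sum
  intro e _
  have : ∏ k, (1 - u e k * y' k) ≤ ∏ k, (1 - u e k * y k) := by
    apply Finset.prod_le_prod
    · intro k _
      nlinarith [hu0 e k, hu1 e k, h1 k, h0 k]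
    · intro k _
      nlinarith [hu0 e k, h k]
  linarith

/-- fractional coordinates -/
noncomputable def fracS {ι : Type*} [Fintype ι] (y : ι → ℝ) : Finset ι := by
  classical exact univ.filter (fun k => y k ≠ 0 ∧ y k ≠ 1)

lemma mem_fracS {ι : Type*} [Fintype ι] (y : ι → ℝ) (k : ι) :
    k ∈ fracS y ↔ y k ≠ 0 ∧ y k ≠ 1 := by
  classical
  simp [fracS]

lemma exists_shift {ι : Type*} [Fintype ι] [DecidableEq ι] (w y : ι → ℝ)
    (hy : ∀ k, y k ∈ Set.Icc (0:ℝ) 1) {i j : ι} (hij : i ≠ j) (hi : i ∈ fracS y)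
    (hj : j ∈ fracS y) (hwi : 0 < w i) (hwj : 0 < w j) :
    ∃ t : ℝ, 0 ≤ t ∧ (∀ k, shiftY w y i j t k ∈ Set.Icc (0:ℝ) 1) ∧
      (fracS (shiftY w y i j t)).card < (fracS y).card := by
  have main : ∀ t : ℝ, 0 ≤ t → t * w j ≤ 1 - y i → t * w i ≤ y j →
      (t * w j = 1 - y i ∨ t * w i = y j) →
      (∀ k, shiftY w y i j t k ∈ Set.Icc (0:ℝ) 1) ∧
      (fracS (shiftY w y i j t)).card < (fracS y).card := by
    intro t ht h1 h2 h3
    have p1 : 0 ≤ t * w j := by positivity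
    have p2 : 0 ≤ t * w i := by positivity
    have ei : shiftY w y i j t i = y i + t * w j := by simp [shiftY]
    have ej : shiftY w y i j t j = y j - t * w i := by simp [shiftY, hij.symm]
    have ek : ∀ k, k ≠ i → k ≠ j → shiftY w y i j t k = y k := by
      intro k a b; simp [shiftY, a, b]
    constructor
    · intro k
      by_cases a : k = i
      · subst a; rw [ei]; exact ⟨by linarith [(hy k).1], by linarith⟩
      · by_cases b : k = j
        · subst b; rw [ej]; exact ⟨by linarith, by linarith [(hy k).2]⟩
        · rw [ek k a b]; exact hy k
    · apply Finset.card_lt_card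
      rw [Finset.ssubset_iff_subset_ne]
      constructor
      · intro k hk
        by_cases a : k = i
        · subst a; exact hi
        · by_cases b : k = j
          · subst b; exact hj
          · rw [mem_fracS, ek k a b] at hk
            rwa [mem_fracS]
      · intro h
        rw [← h] at hi hj
        rw [mem_fracS, ei] at hi
        rw [mem_fracS, ej] at hj
        rcases h3 with h3 | h3
        · exact hi.2 (by linarith)
        · exact hj.1 (by linarith)
  have hi1 := (hy i).2
  have hj0 := (hy j).1
  rcases le_total ((1 - y i) / w j) (y j / w i) with h | h
  · refine ⟨(1 - y i) / w j, div_nonneg (by linarith) hwj.le, main _ (div_nonneg (by linarith) hwj.le)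
      ?_ ?_ (Or.inl ?_)⟩
    · rw [div_mul_cancel₀ _ hwj.ne']
    · rwa [le_div_iff₀ hwi] at h
    · rw [div_mul_cancel₀ _ hwj.ne']
  · refine ⟨y j / w i, div_nonneg hj0 hwi.le, main _ (div_nonneg hj0 hwi.le)
      ?_ ?_ (Or.inr ?_)⟩
    · rwa [le_div_iff₀ hwj] at h
    · rw [div_mul_cancel₀ _ hwi.ne']
    · rw [div_mul_cancel₀ _ hwi.ne']

lemma pipage {V ι : Type*} [Fintype ι] [DecidableEq ι] (X : Finset V) (u : V → ι → ℝ)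
    (hu0 : ∀ e k, 0 ≤ u e k) (hu1 : ∀ e k, u e k ≤ 1) (w : ι → ℝ) (hw : ∀ k, 0 ≤ w k) :
    ∀ n : ℕ, ∀ y : ι → ℝ, (∀ k, y k ∈ Set.Icc (0:ℝ) 1) → (fracS y).card ≤ n →
    ∃ y' : ι → ℝ, (∀ k, y' k ∈ Set.Icc (0:ℝ) 1) ∧ (fracS y').card ≤ 1 ∧
      covG X u y ≤ covG X u y' ∧ ∑ k, w k * y' k ≤ ∑ k, w k * y k := by
  intro n
  induction n with
  | zero => exact fun y hy hn => ⟨y, hy, by omega, le_rfl, le_rfl⟩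
  | succ n ih =>
    intro y hy hn
    by_cases h1 : (fracS y).card ≤ 1
    · exact ⟨y, hy, h1, le_rfl, le_rfl⟩
    by_cases hz : ∃ i ∈ fracS y, w i = 0
    · obtain ⟨i, hi, hwi⟩ := hz
      have hb : ∀ k, Function.update y i 1 k ∈ Set.Icc (0:ℝ) 1 := by
        intro k
        by_cases a : k = i
        · subst a; simp
        · simpa [a] using hy k
      obtain ⟨y', a1, a2, a3, a4⟩ := ih (Function.update y i 1) hb (by
        have : fracS (Function.update y i 1) ⊂ fracS y := by
          rw [Finset.ssubset_iff_of_subset]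
          · exact ⟨i, hi, by simp [mem_fracS]⟩
          · intro k hk
            by_cases a : k = i
            · subst a; exact hi
            · simpa [mem_fracS, a] using hk
        have := Finset.card_lt_card this
        omega)
      refine ⟨y', a1, a2, le_trans ?_ a3, a4.trans (le_of_eq ?_)⟩
      · apply covG_mono X u hu0 hu1 _ _ (fun k => (hb k).2) (fun k => (hb k).1)
        intro k
        by_cases a : k = i
        · subst a; simpa using (hy k).2
        · simp [a]
      · apply Finset.sum_congr rfl
        intro k _
        by_cases a : k = i
        · subst a; simp [hwi]
        · simp [a]
    · push Not at hz
      obtain ⟨i, hi, j, hj, hij⟩ := Finset.one_lt_card.mp (not_le.mp h1)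
      have hwi := lt_of_le_of_ne (hw i) (hz i hi).symm
      have hwj := lt_of_le_of_ne (hw j) (hz j hj).symm
      obtain ⟨c, hc⟩ := covG_shift X u hu0 hu1 w y hw hy hij
      have fin : ∀ t, 0 ≤ c * t → (∀ k, shiftY w y i j t k ∈ Set.Icc (0:ℝ) 1) →
          (fracS (shiftY w y i j t)).card < (fracS y).card →
          ∃ y' : ι → ℝ, (∀ k, y' k ∈ Set.Icc (0:ℝ) 1) ∧ (fracS y').card ≤ 1 ∧
          covG X u y ≤ covG X u y' ∧ ∑ k, w k * y' k ≤ ∑ k, w k * y k := by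
        intro t ht hb hcard
        obtain ⟨y', a1, a2, a3, a4⟩ := ih _ hb (by omega)
        refine ⟨y', a1, a2, ?_, ?_⟩
        · linarith [hc t]
        · rwa [shift_weight w y hij] at a4
      rcases le_total 0 c with h | h
      · obtain ⟨t, ht, hb, hcard⟩ := exists_shift w y hy hij hi hj hwi hwj
        exact fin t (mul_nonneg h ht) hb hcard
      · obtain ⟨t, ht, hb, hcard⟩ := exists_shift w y hy hij.symm hj hi hwj hwi
        rw [shiftY_swap w y hij] at hb hcard
        exact fin (-t) (by nlinarith) hb hcard

lemma prod_one_sub_bound {ι : Type*} (s : Finset ι) (f : ι → ℝ) (h0 : ∀ k, 0 ≤ f k)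
    (h1 : ∀ k, f k ≤ 1) : 0 ≤ ∏ k ∈ s, (1 - f k) ∧ (∏ k ∈ s, (1 - f k)) * (1 + ∑ k ∈ s, f k) ≤ 1 := by
  classical
  induction s using Finset.induction_on with
  | empty => simp
  | insert a s ha ih =>
    rw [Finset.prod_insert ha, Finset.sum_insert ha]
    obtain ⟨p, q⟩ := ih
    have hs : 0 ≤ ∑ k ∈ s, f k := Finset.sum_nonneg fun k _ => h0 k
    refine ⟨mul_nonneg (by linarith [h1 a]) p, ?_⟩
    have e1 : 0 ≤ (∏ k ∈ s, (1 - f k)) * (f a * (f a + ∑ k ∈ s, f k)) :=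
      mul_nonneg p (mul_nonneg (h0 a) (add_nonneg (h0 a) hs))
    nlinarith

/-- main rounding guarantee for shallow instances. If `(x, z)` is a
feasible partial set cover LP solution for `(X, S, k)` in which `x_i < a` for every set
and `∑_{i : e ∈ S_i} x_i ≤ a` for every element (with `0 < a ≤ 1/2`), then there is a
collection `Σ' ⊆ S` covering at least `k` elements of `X` with
`w(Σ') ≤ (1/a)·∑_i w_i x_i + B`, where `B` bounds the weight of every set in `S`. -/
theorem stmt15 {V ι : Type*} [DecidableEq V] [Fintype ι]
    (X : Finset V) (Sset : ι → Finset V) (hsub : ∀ i, Sset i ⊆ X)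
    (w : ι → ℝ) (hw : ∀ i, 0 ≤ w i) (k : ℤ)
    (a : ℝ) (ha : 0 < a) (ha2 : a ≤ 1/2)
    (x : ι → ℝ) (z : V → ℝ)
    (hx : ∀ i, x i ∈ Set.Icc (0:ℝ) 1) (hz : ∀ e ∈ X, z e ∈ Set.Icc (0:ℝ) 1)
    (hconstr : ∀ e ∈ X, z e ≤ ∑ i ∈ Finset.univ.filter (fun i => e ∈ Sset i), x i)
    (hk : (k : ℝ) ≤ ∑ e ∈ X, z e)
    (hshallow1 : ∀ i, x i < a)
    (hshallow2 : ∀ e ∈ X, ∑ i ∈ Finset.univ.filter (fun i => e ∈ Sset i), x i ≤ a)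
    (B : ℝ) (hB0 : 0 ≤ B) (hB : ∀ i, w i ≤ B) :
    ∃ T : Finset ι, k ≤ ((X ∩ T.biUnion Sset).card : ℤ) ∧
      T.sum w ≤ (1/a) * ∑ i, w i * x i + B := by
  classical
  set u : V → ι → ℝ := fun e i => if e ∈ Sset i then 1 else 0 with hu
  have hu0 : ∀ e k, 0 ≤ u e k := by intro e k; simp only [hu]; split_ifs <;> norm_num
  have hu1 : ∀ e k, u e k ≤ 1 := by intro e k; simp only [hu]; split_ifs <;> norm_num
  have hy : ∀ k, x k / a ∈ Set.Icc (0:ℝ) 1 := fun k =>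
    ⟨div_nonneg (hx k).1 ha.le, by rw [div_le_one ha]; exact (hshallow1 k).le⟩
  have hG : (k : ℝ) ≤ covG X u (fun k => x k / a) := by
    refine hk.trans ?_
    unfold covG
    apply Finset.sum_le_sum
    intro e he
    have hs : ∑ k, u e k * (x k / a) =
        (∑ i ∈ Finset.univ.filter (fun i => e ∈ Sset i), x i) / a := by
      rw [Finset.sum_filter, Finset.sum_div]
      apply Finset.sum_congr rfl
      intro k _
      simp only [hu]
      split_ifs <;> simp
    obtain ⟨p, q⟩ := prod_one_sub_bound univ (fun k => u e k * (x k / a))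
      (fun k => mul_nonneg (hu0 e k) (hy k).1)
      (fun k => mul_le_one₀ (hu1 e k) (hy k).1 (hy k).2)
    rw [hs] at q
    set P := ∏ k, (1 - u e k * (x k / a))
    set s := ∑ i ∈ Finset.univ.filter (fun i => e ∈ Sset i), x i with hsdef
    have hz0 := (hz e he).1
    have c1 : z e ≤ s := hconstr e he
    have c2 : s ≤ a := hshallow2 e he
    have d1 : s / a ≤ 1 := by rw [div_le_one ha]; exact c2
    have d2 : 2 * s ≤ s / a := by
      rw [le_div_iff₀ ha]; nlinarith
    set r := s / a
    have hr : 0 ≤ r := by linarith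
    have : r / 2 ≤ 1 - P := by
      have h3 : (1:ℝ) ≤ (1 - r / 2) * (1 + r) := by nlinarith
      have h4 : P * (1 + r) ≤ (1 - r / 2) * (1 + r) := q.trans h3
      have := le_of_mul_le_mul_right h4 (by linarith)
      linarith
    linarith
  obtain ⟨y, hyb, hfrac, hGy, hwy⟩ := pipage X u hu0 hu1 w hw _ _ hy le_rfl
  have hround : covG X u y ≤
      ((X ∩ (univ.filter (fun k => y k ≠ 0)).biUnion Sset).card : ℝ) := by
    rw [← Finset.filter_mem_eq_inter, Finset.card_filter]
    push_cast
    unfold covG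
    apply Finset.sum_le_sum
    intro e _
    split_ifs with h
    · have : 0 ≤ ∏ k, (1 - u e k * y k) := Finset.prod_nonneg fun k _ => by
        linarith [mul_le_one₀ (hu1 e k) (hyb k).1 (hyb k).2]
      linarith
    · have : ∏ k, (1 - u e k * y k) = 1 := by
        apply Finset.prod_eq_one
        intro k _
        by_cases h0 : y k = 0
        · simp [h0]
        · have : e ∉ Sset k := fun hm => h (by
            rw [Finset.mem_biUnion]; exact ⟨k, by simp [h0], hm⟩)
          simp [hu, this]
      rw [this]; simp
  refine ⟨univ.filter (fun k => y k ≠ 0), ?_, ?_⟩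
  · have := hG.trans (hGy.trans hround)
    exact_mod_cast this
  · have e1 : (1/a) * ∑ i, w i * x i = ∑ k, w k * (x k / a) := by
      rw [Finset.mul_sum]
      apply Finset.sum_congr rfl
      intro k _
      ring
    rw [e1]
    have e2 : ∑ k ∈ univ.filter (fun k => y k ≠ 0), w k ≤ ∑ k, w k * y k + ∑ k ∈ fracS y, w k := by
      have : fracS y = univ.filter (fun k => y k ≠ 0 ∧ y k ≠ 1) := by
        ext k; simp [mem_fracS]
      rw [this, Finset.sum_filter, Finset.sum_filter, ← Finset.sum_add_distrib]
      apply Finset.sum_le_sum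
      intro k _
      have := mul_nonneg (hw k) (hyb k).1
      by_cases h0 : y k = 0
      · simp [h0]
      · by_cases h1 : y k = 1
        · simp [h1]
        · simp [h0, h1, this]
    have e3 : ∑ k ∈ fracS y, w k ≤ B := by
      refine (Finset.sum_le_card_nsmul _ _ B fun k _ => hB k).trans ?_
      rw [nsmul_eq_mul]
      have : ((fracS y).card : ℝ) ≤ 1 := by exact_mod_cast hfrac
      nlinarith
    linarith
end
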